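/- For every k ≥ 0, the string β_k has length 2^{k+1} − 1; in particular, for every n there exists a palindromic nonrepetitive string over {0,1,2} of length at least n. -/

import Mathlib

/-- A list is nonrepetitive if no nonempty block of consecutive terms forms a
repetition `s₁, …, s_j, s₁, …, s_j`. -/
def NonrepetitiveList {α : Type*} (l : List α) : Prop :=
  ∀ w : List α, w ≠ [] → ¬ (w ++ w) <:+: l

/-- The complement of a string over `{0,1,2}`:
`\overline{a₁ a₂ … aₙ} = (2-a₁)(2-a₂)…(2-aₙ)`. -/
def comp3 (l : List ℕ) : List ℕ := l.map (fun a => 2 - a)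

/-- Thue's strings over `{0,1,2}`: `β₀ = 2` and, for `i ≥ 1`,
`βᵢ = β_{i-1} · 2 · \overline{β_{i-1}}` if `i` is even and
`βᵢ = β_{i-1} · 1 · \overline{β_{i-1}}` if `i` is odd. -/
def beta : ℕ → List ℕ
  | 0 => [2]
  | i + 1 =>
      if Even (i + 1) then beta i ++ [2] ++ comp3 (beta i)
      else beta i ++ [1] ++ comp3 (beta i)

/-- The Thue–Morse sequence: the parity of the number of ones in the binary expansion. -/
def thueMorse : ℕ → Bool
  | 0 => false
  | n + 1 => xor (n + 1).bodd (thueMorse ((n + 1) / 2))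

lemma thueMorse_zero : thueMorse 0 = false := by rw [thueMorse]

lemma thueMorse_two_mul (n : ℕ) : thueMorse (2 * n) = thueMorse n := by
  rcases n with _ | n
  · rfl
  · rw [show 2 * (n + 1) = (2 * n + 1) + 1 by ring, thueMorse,
      show (2 * n + 1 + 1) / 2 = n + 1 by omega]
    simp

lemma thueMorse_two_mul_add_one (n : ℕ) : thueMorse (2 * n + 1) = !thueMorse n := by
  rw [thueMorse, show (2 * n + 1) / 2 = n by omega]
  simp

lemma thueMorse_two_pow_add (k : ℕ) :
    ∀ n < 2 ^ k, thueMorse (2 ^ k + n) = !thueMorse n := by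
  induction k with
  | zero =>
    intro n hn
    obtain rfl : n = 0 := by simpa using hn
    simpa using thueMorse_two_mul_add_one 0
  | succ k ih =>
    intro n hn
    obtain ⟨m, rfl | rfl⟩ := n.even_or_odd'
    · rw [show 2 ^ (k + 1) + 2 * m = 2 * (2 ^ k + m) by ring, thueMorse_two_mul,
        thueMorse_two_mul, ih m (by rw [pow_succ] at hn; omega)]
    · rw [show 2 ^ (k + 1) + (2 * m + 1) = 2 * (2 ^ k + m) + 1 by ring,
        thueMorse_two_mul_add_one, thueMorse_two_mul_add_one,
        ih m (by rw [pow_succ] at hn; omega)]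

lemma thueMorse_two_pow (k : ℕ) : thueMorse (2 ^ k) = true := by
  simpa [thueMorse_zero] using thueMorse_two_pow_add k 0 (by positivity)

lemma thueMorse_two_pow_sub_one (k : ℕ) : thueMorse (2 ^ k - 1) = decide (Odd k) := by
  induction k with
  | zero => simp [thueMorse_zero]
  | succ k ih =>
    have h : 1 ≤ 2 ^ k := Nat.one_le_two_pow
    rw [show 2 ^ (k + 1) - 1 = 2 * (2 ^ k - 1) + 1 by rw [pow_succ]; omega,
      thueMorse_two_mul_add_one, ih]
    simp [Nat.odd_add_one, ← decide_not]

lemma odd_of_thueMorse_eq_succ {n : ℕ} (h : thueMorse n = thueMorse (n + 1)) : Odd n := by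
  by_contra hn
  obtain ⟨m, rfl⟩ := even_iff_exists_two_mul.mp (Nat.not_odd_iff_even.mp hn)
  rw [thueMorse_two_mul, thueMorse_two_mul_add_one] at h
  simp at h

/-- The Thue–Morse sequence is overlap-free. -/
theorem thueMorse_overlap_free (p : ℕ) :
    0 < p → ∀ i, ¬ ∀ j ≤ p, thueMorse (i + j) = thueMorse (i + p + j) := by
  induction p using Nat.strong_induction_on with
  | _ p ih =>
    intro hp i h
    obtain ⟨q, rfl | rfl⟩ := p.even_or_odd'
    · obtain ⟨m, rfl | rfl⟩ := i.even_or_odd'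
      · refine ih q (by omega) (by omega) m fun j hj => ?_
        have := h (2 * j) (by omega)
        rwa [← mul_add, ← mul_add, ← mul_add, thueMorse_two_mul, thueMorse_two_mul] at this
      · refine ih q (by omega) (by omega) m fun j hj => ?_
        have := h (2 * j) (by omega)
        rw [show 2 * m + 1 + 2 * j = 2 * (m + j) + 1 by ring,
          show 2 * m + 1 + 2 * q + 2 * j = 2 * (m + q + j) + 1 by ring,
          thueMorse_two_mul_add_one, thueMorse_two_mul_add_one] at this
        simpa using this
    · have alternating : ∀ j ≤ 2 * q + 1,
          thueMorse (i + j) = xor (thueMorse i) (decide (Odd j)) := by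
        intro j
        induction j with
        | zero => simp
        | succ j ihj =>
          intro hj
          have hne : thueMorse (i + j) ≠ thueMorse (i + j + 1) := by
            intro heq
            have h₁ := odd_of_thueMorse_eq_succ heq
            have h₂ : Odd (i + (2 * q + 1) + j) := by
              apply odd_of_thueMorse_eq_succ
              rw [← h j (by omega), add_assoc _ j 1, ← h (j + 1) hj, heq, add_assoc]
            rw [Nat.odd_iff] at h₁ h₂
            omega
          rw [ihj (by omega)] at hne
          rw [← add_assoc, Bool.eq_not_of_ne hne.symm]
          simp [Nat.odd_add_one]
          by_cases hj : Odd j <;> simp [hj, ← Nat.not_odd_iff_even]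
      have h₀ := h 0 (by omega)
      have h₁ := alternating (2 * q + 1) le_rfl
      simp only [add_zero] at h₀
      rw [← h₀] at h₁
      simp at h₁

/-- The difference sequence `t (n + 1) - t n + 1` of the Thue–Morse sequence `t`. -/
def thueMorseDiff (n : ℕ) : ℕ := (thueMorse (n + 1)).toNat + 1 - (thueMorse n).toNat

lemma thueMorseDiff_le_two (n : ℕ) : thueMorseDiff n ≤ 2 := by
  unfold thueMorseDiff
  have := (thueMorse (n + 1)).toNat_le
  omega

lemma thueMorseDiff_square_free {p : ℕ} (hp : 0 < p) (i : ℕ) :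
    ¬ ∀ j < p, thueMorseDiff (i + j) = thueMorseDiff (i + p + j) := by
  intro h
  let τ : ℕ → ℤ := fun n => (thueMorse n).toNat
  have shift : ∀ j ≤ p, τ (i + p + j) - τ (i + j) = τ (i + p) - τ i := by
    intro j
    induction j with
    | zero => simp
    | succ j ihj =>
      intro hj
      have h₁ := h j (by omega)
      have h₂ := ihj (by omega)
      have := (thueMorse (i + j)).toNat_le
      have := (thueMorse (i + p + j)).toNat_le
      simp only [thueMorseDiff, τ, ← add_assoc] at h₁ h₂ ⊢
      omega
  have hend := shift p le_rfl
  refine thueMorse_overlap_free p hp i fun j hj => ?_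
  have hj := shift j hj
  have := (thueMorse i).toNat_le
  have := (thueMorse (i + p + p)).toNat_le
  have := (thueMorse (i + p)).toNat_le
  have heq : (thueMorse (i + j)).toNat = (thueMorse (i + p + j)).toNat := by
    simp only [τ] at hend hj
    omega
  revert heq
  cases thueMorse (i + j) <;> cases thueMorse (i + p + j) <;> simp

lemma nonrepetitiveList_map_range_thueMorseDiff (n : ℕ) :
    NonrepetitiveList ((List.range n).map thueMorseDiff) := by
  rintro w hw ⟨s, t, h⟩
  refine thueMorseDiff_square_free (List.length_pos_iff.mpr hw) s.length fun j hj => ?_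
  have hlen := congrArg List.length h
  simp only [List.length_append, List.length_map, List.length_range] at hlen
  have h₁ := congrArg (fun l => l[s.length + j]?) h
  have h₂ := congrArg (fun l => l[s.length + w.length + j]?) h
  simp only [List.append_assoc, add_assoc, List.getElem?_append_right (Nat.le_add_right _ _),
    Nat.add_sub_cancel_left, List.getElem?_append_left hj, List.getElem?_map] at h₁ h₂
  rw [List.getElem?_range (by omega)] at h₁ h₂
  rw [h₁] at h₂
  simpa [add_assoc] using h₂

lemma beta_eq_map_range (k : ℕ) :
    beta k = (List.range (2 ^ (k + 1) - 1)).map thueMorseDiff := by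
  induction k with
  | zero =>
    have h := thueMorse_two_pow 0
    simp_all [beta, thueMorseDiff, thueMorse_zero]
  | succ k ih =>
    have hpos : 1 ≤ 2 ^ (k + 1) := Nat.one_le_two_pow
    have hsplit : List.range (2 ^ (k + 1 + 1) - 1) =
        List.range (2 ^ (k + 1) - 1) ++ [2 ^ (k + 1) - 1] ++
          (List.range (2 ^ (k + 1) - 1)).map (2 ^ (k + 1) + ·) := by
      rw [← List.range_succ, Nat.succ_eq_add_one, Nat.sub_add_cancel hpos, ← List.range_add]
      congr 1
      rw [pow_succ 2 (k + 1)]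
      omega
    have hmid : thueMorseDiff (2 ^ (k + 1) - 1) = if Even (k + 1) then 2 else 1 := by
      rw [thueMorseDiff, Nat.sub_add_cancel hpos, thueMorse_two_pow, thueMorse_two_pow_sub_one]
      split_ifs with h
      · simp [Nat.not_odd_iff_even.mpr h]
      · simp [Nat.not_even_iff_odd.mp h]
    have hcomp : comp3 (beta k) =
        ((List.range (2 ^ (k + 1) - 1)).map (2 ^ (k + 1) + ·)).map thueMorseDiff := by
      rw [ih, comp3, List.map_map, List.map_map]
      refine List.map_congr_left fun n hn => ?_
      rw [List.mem_range] at hn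
      simp only [Function.comp, thueMorseDiff]
      rw [add_assoc, thueMorse_two_pow_add _ n (by omega),
        thueMorse_two_pow_add _ (n + 1) (by omega)]
      cases thueMorse n <;> cases thueMorse (n + 1) <;> rfl
    rw [hsplit, List.map_append, List.map_append, ← hcomp, ← ih, List.map_singleton, hmid, beta]
    split_ifs <;> rfl

lemma length_beta (k : ℕ) : (beta k).length = 2 ^ (k + 1) - 1 := by
  simp [beta_eq_map_range]

lemma le_two_of_mem_beta {k a : ℕ} (ha : a ∈ beta k) : a ≤ 2 := by
  rw [beta_eq_map_range] at ha
  obtain ⟨n, -, rfl⟩ := List.mem_map.mp ha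
  exact thueMorseDiff_le_two n

lemma comp3_comp3 {l : List ℕ} (h : ∀ a ∈ l, a ≤ 2) : comp3 (comp3 l) = l := by
  rw [comp3, comp3, List.map_map]
  exact (List.map_congr_left fun a ha => Nat.sub_sub_self (h a ha)).trans (List.map_id l)

lemma comp3_append (l₁ l₂ : List ℕ) : comp3 (l₁ ++ l₂) = comp3 l₁ ++ comp3 l₂ :=
  List.map_append

lemma reverse_beta (k : ℕ) :
    (beta k).reverse = if Even k then beta k else comp3 (beta k) := by
  induction k with
  | zero => rfl
  | succ k ih =>
    have hcc := comp3_comp3 fun a => le_two_of_mem_beta (k := k) (a := a)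
    have hrev : (comp3 (beta k)).reverse = comp3 (beta k).reverse := by simp [comp3]
    by_cases hk : Even k
    · have hk' : ¬ Even (k + 1) := by simpa [Nat.even_add_one] using hk
      rw [if_pos hk] at ih
      rw [if_neg hk', beta, if_neg hk']
      rw [comp3_append, comp3_append, hcc, show comp3 [1] = [1] from rfl]
      simp [hrev, ih]
    · have hk' : Even (k + 1) := Nat.even_add_one.mpr hk
      rw [if_neg hk] at ih
      rw [if_pos hk', beta, if_pos hk']
      simp [hrev, ih, hcc]

/-- For every `k ≥ 0` the string `β_k` has length `2^{k+1} - 1`; in particular, for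
every `n` there exists a palindromic nonrepetitive string over `{0,1,2}` of length at
least `n`. -/
theorem beta_length_and_long_palindromes :
    (∀ k : ℕ, (beta k).length = 2 ^ (k + 1) - 1) ∧
    (∀ n : ℕ, ∃ l : List ℕ, (∀ a ∈ l, a ≤ 2) ∧ l.reverse = l ∧
      NonrepetitiveList l ∧ n ≤ l.length) := by
  refine ⟨length_beta, fun n => ⟨beta (2 * n), fun a => le_two_of_mem_beta, ?_, ?_, ?_⟩⟩
  · rw [reverse_beta, if_pos (even_two_mul n)]
  · rw [beta_eq_map_range]
    exact nonrepetitiveList_map_range_thueMorseDiff _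
  · rw [length_beta]
    have := Nat.lt_two_pow_self (n := 2 * n + 1)
    omega
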